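/- Uniqueness of the 𝔭₂-invariant contravariant metric on the region x·x > 0: let U = {x ∈ ℝ⁴ : x·x > 0 and x⁰ > 0}. If h : U → (symmetric 4×4 real matrices), x ↦ (h^{μν}(x)), is smooth and satisfies (ℒ_ξ h)^{μν} = 0 on U for every 𝔭₂ vector field ξ, then there exists a constant C ∈ ℝ such that h^{μν}(x) = C · (x·x) x^μ x^ν for all x ∈ U. -/

import Mathlib

noncomputable section

open scoped BigOperators

/-- The Minkowski metric η = diag(1,−1,−1,−1), as a function of two indices. -/
def etaF : Fin 4 → Fin 4 → ℝ := fun μ ν => if μ = ν then (if μ = 0 then 1 else -1) else 0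

/-- The Minkowski product x·y = η_{μν} x^μ y^ν. -/
def mdot (x y : Fin 4 → ℝ) : ℝ := ∑ μ, ∑ ν, etaF μ ν * x μ * y ν

/-- The lowered index x_μ = η_{μν} x^ν. -/
def lowr (x : Fin 4 → ℝ) (μ : Fin 4) : ℝ := ∑ ν, etaF μ ν * x ν

/-- The partial derivative ∂_λ f (x). -/
def pdv (f : (Fin 4 → ℝ) → ℝ) (lam : Fin 4) (x : Fin 4 → ℝ) : ℝ :=
  fderiv ℝ f x (Pi.single lam 1)

/-- A ∈ 𝔰𝔬(1,3), i.e. Aᵀη + ηA = 0, written componentwise. -/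
def so13 (A : Fin 4 → Fin 4 → ℝ) : Prop :=
  ∀ μ ν, (∑ κ, A κ μ * etaF κ ν) + (∑ κ, etaF μ κ * A κ ν) = 0

/-- The 𝔭₂ vector field ξ(x) = A x + (b·x) x. -/
def xiP2 (A : Fin 4 → Fin 4 → ℝ) (b : Fin 4 → ℝ) (x : Fin 4 → ℝ) : Fin 4 → ℝ :=
  fun μ => (∑ ν, A μ ν * x ν) + mdot b x * x μ

/-- Lie derivative of a covariant symmetric 2-tensor field g along a vector field ξ:
  (ℒ_ξ g)_{μν} = ξ^λ ∂_λ g_{μν} + g_{μλ} ∂_ν ξ^λ + g_{λν} ∂_μ ξ^λ. -/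
def lieG (ξf : (Fin 4 → ℝ) → Fin 4 → ℝ) (g : (Fin 4 → ℝ) → Fin 4 → Fin 4 → ℝ)
    (x : Fin 4 → ℝ) (μ ν : Fin 4) : ℝ :=
  (∑ lam, ξf x lam * pdv (fun y => g y μ ν) lam x)
  + (∑ lam, g x μ lam * pdv (fun y => ξf y lam) ν x)
  + (∑ lam, g x lam ν * pdv (fun y => ξf y lam) μ x)

/-- Lie derivative of a contravariant symmetric 2-tensor field h along a vector field ξ:
  (ℒ_ξ h)^{μν} = ξ^λ ∂_λ h^{μν} − h^{μλ} ∂_λ ξ^ν − h^{λν} ∂_λ ξ^μ. -/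
def lieH (ξf : (Fin 4 → ℝ) → Fin 4 → ℝ) (h : (Fin 4 → ℝ) → Fin 4 → Fin 4 → ℝ)
    (x : Fin 4 → ℝ) (μ ν : Fin 4) : ℝ :=
  (∑ lam, ξf x lam * pdv (fun y => h y μ ν) lam x)
  - (∑ lam, h x μ lam * pdv (fun y => ξf y ν) lam x)
  - (∑ lam, h x lam ν * pdv (fun y => ξf y μ) lam x)

/-- Lie derivative of a connection Γ^μ_{νρ} along a vector field ξ ([ℒ_ξ, ∇]):
  ξ^λ ∂_λ Γ^μ_{νρ} − Γ^λ_{νρ} ∂_λ ξ^μ + Γ^μ_{λρ} ∂_ν ξ^λ + Γ^μ_{νλ} ∂_ρ ξ^λ + ∂_ν ∂_ρ ξ^μ. -/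
def lieConn (ξf : (Fin 4 → ℝ) → Fin 4 → ℝ)
    (Γ : (Fin 4 → ℝ) → Fin 4 → Fin 4 → Fin 4 → ℝ)
    (x : Fin 4 → ℝ) (μ ν ρ : Fin 4) : ℝ :=
  (∑ lam, ξf x lam * pdv (fun y => Γ y μ ν ρ) lam x)
  - (∑ lam, Γ x lam ν ρ * pdv (fun y => ξf y μ) lam x)
  + (∑ lam, Γ x μ lam ρ * pdv (fun y => ξf y lam) ν x)
  + (∑ lam, Γ x μ ν lam * pdv (fun y => ξf y lam) ρ x)
  + pdv (fun y => pdv (fun z => ξf z μ) ρ y) ν x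

/-- The canonical degenerate covariant metric g_{μν}(x) = (x_μ x_ν − (x·x) η_{μν})/(x·x)². -/
def gC (x : Fin 4 → ℝ) (μ ν : Fin 4) : ℝ :=
  (lowr x μ * lowr x ν - mdot x x * etaF μ ν) / (mdot x x) ^ 2

/-- The canonical degenerate contravariant metric h^{μν}(x) = (x·x) x^μ x^ν. -/
def hC (x : Fin 4 → ℝ) (μ ν : Fin 4) : ℝ := mdot x x * x μ * x ν

/-- The canonical connection Γ^μ_{νλ}(x) = −(x_ν δ^μ_λ + δ^μ_ν x_λ)/(x·x). -/
def GammaC (x : Fin 4 → ℝ) (μ ν lam : Fin 4) : ℝ :=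
  -(lowr x ν * (if μ = lam then 1 else 0) + (if μ = ν then 1 else 0) * lowr x lam) / mdot x x

theorem mdot_eq (x y : Fin 4 → ℝ) :
    mdot x y = x 0 * y 0 - x 1 * y 1 - x 2 * y 2 - x 3 * y 3 := by
  simp [mdot, etaF, Fin.sum_univ_four]
  ring

theorem lowr_eq (x : Fin 4 → ℝ) (μ : Fin 4) :
    lowr x μ = (if μ = 0 then 1 else -1) * x μ := by
  simp [lowr, etaF]

theorem mdot_lowr (x y : Fin 4 → ℝ) : mdot x y = ∑ μ, lowr x μ * y μ := by
  simp [mdot_eq, lowr_eq, Fin.sum_univ_four]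
  ring

theorem fderiv_sum_pdv (f : (Fin 4 → ℝ) → ℝ) (x v : Fin 4 → ℝ) :
    fderiv ℝ f x v = ∑ lam, v lam * pdv f lam x := by
  have hv : v = ∑ i, v i • (Pi.single i (1 : ℝ) : Fin 4 → ℝ) := by
    ext j
    simp [Finset.sum_apply, Pi.single_apply]
  conv_lhs => rw [hv]
  simp [pdv, map_sum]

theorem pdv_xi (A : Fin 4 → Fin 4 → ℝ) (b x : Fin 4 → ℝ) (ν lam : Fin 4) :
    pdv (fun y => xiP2 A b y ν) lam x
      = A ν lam + lowr b lam * x ν + mdot b x * (if ν = lam then 1 else 0) := by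
  have hp : ∀ i : Fin 4, HasFDerivAt (fun y : Fin 4 → ℝ => y i)
      (ContinuousLinearMap.proj (R := ℝ) (φ := fun _ : Fin 4 => ℝ) i) x :=
    fun i => hasFDerivAt_apply i x
  have h1 : HasFDerivAt (fun y : Fin 4 → ℝ => ∑ i, A ν i * y i)
      (∑ i, A ν i • ContinuousLinearMap.proj (R := ℝ) (φ := fun _ : Fin 4 => ℝ) i) x :=
    HasFDerivAt.fun_sum (fun i _ => (hp i).const_mul (A ν i))
  have h2 : HasFDerivAt (fun y : Fin 4 → ℝ => mdot b y)
      (∑ i, lowr b i • ContinuousLinearMap.proj (R := ℝ) (φ := fun _ : Fin 4 => ℝ) i) x := by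
    simp only [mdot_lowr]
    exact HasFDerivAt.fun_sum (fun i _ => (hp i).const_mul (lowr b i))
  have h3 := h1.add (h2.mul (hp ν))
  have h4 : HasFDerivAt (fun y => xiP2 A b y ν) _ x := h3
  rw [pdv, h4.fderiv]
  simp [Pi.single_apply]
  ring

theorem lieH_eq (A : Fin 4 → Fin 4 → ℝ) (b : Fin 4 → ℝ)
    (h : (Fin 4 → ℝ) → Fin 4 → Fin 4 → ℝ) (x : Fin 4 → ℝ) (μ ν : Fin 4) :
    lieH (xiP2 A b) h x μ ν = fderiv ℝ (fun y => h y μ ν) x (xiP2 A b x)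
      - (∑ lam, h x μ lam *
          (A ν lam + lowr b lam * x ν + mdot b x * (if ν = lam then 1 else 0)))
      - (∑ lam, h x lam ν *
          (A μ lam + lowr b lam * x μ + mdot b x * (if μ = lam then 1 else 0))) := by
  simp only [lieH, pdv_xi, fderiv_sum_pdv]

theorem mdot_pos {x y : Fin 4 → ℝ} (hx : 0 < mdot x x ∧ 0 < x 0)
    (hy : 0 < mdot y y ∧ 0 < y 0) : 0 < mdot x y := by
  obtain ⟨hx, hx0⟩ := hx
  obtain ⟨hy, hy0⟩ := hy
  rw [mdot_eq] at *
  have hcs : (x 1 * y 1 + x 2 * y 2 + x 3 * y 3) ^ 2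
      ≤ (x 1 ^ 2 + x 2 ^ 2 + x 3 ^ 2) * (y 1 ^ 2 + y 2 ^ 2 + y 3 ^ 2) := by
    nlinarith [sq_nonneg (x 1 * y 2 - x 2 * y 1), sq_nonneg (x 1 * y 3 - x 3 * y 1),
      sq_nonneg (x 2 * y 3 - x 3 * y 2)]
  have hlt : (x 1 ^ 2 + x 2 ^ 2 + x 3 ^ 2) * (y 1 ^ 2 + y 2 ^ 2 + y 3 ^ 2)
      < x 0 ^ 2 * y 0 ^ 2 :=
    mul_lt_mul'' (by nlinarith) (by nlinarith) (by positivity) (by positivity)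
  have := abs_lt_of_sq_lt_sq (a := x 1 * y 1 + x 2 * y 2 + x 3 * y 3) (b := x 0 * y 0)
    (by nlinarith) (by positivity)
  linarith [(abs_lt.mp this).2]

theorem U_convex : Convex ℝ {x : Fin 4 → ℝ | 0 < mdot x x ∧ 0 < x 0} := by
  intro x hx y hy a b ha hb hab
  have hxy := mdot_pos hx hy
  obtain ⟨hx, hx0⟩ := hx
  obtain ⟨hy, hy0⟩ := hy
  have hexp : mdot (a • x + b • y) (a • x + b • y)
      = a ^ 2 * mdot x x + 2 * (a * b) * mdot x y + b ^ 2 * mdot y y := by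
    simp only [mdot_eq, Pi.add_apply, Pi.smul_apply, smul_eq_mul]
    ring
  have hab2 : 0 < a ∨ 0 < b := by
    by_contra! hc
    linarith
  refine ⟨?_, ?_⟩
  · rw [hexp]
    rcases hab2 with h | h <;> positivity
  · simp only [Pi.add_apply, Pi.smul_apply, smul_eq_mul]
    rcases hab2 with h | h <;> positivity

theorem U_open : IsOpen {x : Fin 4 → ℝ | 0 < mdot x x ∧ 0 < x 0} := by
  simp only [mdot_eq]
  have h1 : IsOpen {x : Fin 4 → ℝ | 0 < x 0 * x 0 - x 1 * x 1 - x 2 * x 2 - x 3 * x 3} :=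
    isOpen_lt (by fun_prop) (by fun_prop)
  have h2 : IsOpen {x : Fin 4 → ℝ | 0 < x 0} := isOpen_lt (by fun_prop) (by fun_prop)
  exact h1.inter h2

theorem h_form (h : (Fin 4 → ℝ) → Fin 4 → Fin 4 → ℝ) (x : Fin 4 → ℝ) (hx0 : 0 < x 0)
    (hsym : ∀ μ ν, h x μ ν = h x ν μ)
    (hinv : ∀ A : Fin 4 → Fin 4 → ℝ, ∀ b : Fin 4 → ℝ, so13 A →
      ∀ μ ν, lieH (xiP2 A b) h x μ ν = 0) (μ ν : Fin 4) :
    h x μ ν = h x 0 0 / x 0 ^ 2 * (x μ * x ν) := by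
  have hne := hx0.ne'
  have h0 : so13 (fun _ _ => 0) := by intro μ ν; simp
  have key : ∀ μ κ, h x μ κ * x 0 = x κ * h x μ 0 := by
    intro μ κ
    let w : Fin 4 → ℝ := fun l => x 0 * (if l = κ then 1 else 0) - x κ * (if l = 0 then 1 else 0)
    let b : Fin 4 → ℝ := lowr w
    have hlb : ∀ l, lowr b l = w l := by
      intro l
      simp only [b, lowr_eq]
      split_ifs <;> ring
    have hbx : mdot b x = 0 := by
      rw [mdot_lowr]
      simp only [hlb, w, sub_mul, Finset.sum_sub_distrib]
      simp
      ring
    have hxi : xiP2 (fun _ _ => 0) b x = 0 := by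
      ext i; simp [xiP2, hbx]
    have hc : ∀ m, ∑ l, h x m l * w l = h x m κ * x 0 - x κ * h x m 0 := by
      intro m
      simp only [w, mul_sub, Finset.sum_sub_distrib]
      simp
      ring
    have heq : ∀ m n, (∑ l, h x m l * w l) * x n + (∑ l, h x n l * w l) * x m = 0 := by
      intro m n
      have := hinv _ b h0 m n
      rw [lieH_eq, hxi, hbx] at this
      simp only [hlb, map_zero, zero_mul, add_zero, zero_add] at this
      rw [Finset.sum_mul, Finset.sum_mul]
      simp only [hsym _ n, ← mul_assoc] at this
      linarith
    simp only [hc] at heq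
    have e0 := heq 0 0
    have e1 := heq μ 0
    have e2 : h x 0 κ * x 0 - x κ * h x 0 0 = 0 := by
      have : (h x 0 κ * x 0 - x κ * h x 0 0) * x 0 = 0 := by linarith
      simpa [hne] using this
    rw [e2] at e1
    have e3 : h x μ κ * x 0 - x κ * h x μ 0 = 0 := by
      simpa [hne] using e1
    linarith
  have k1 := key μ ν
  have k2 := key 0 μ
  rw [hsym 0 μ] at k2
  field_simp
  linear_combination x 0 * k1 + x ν * k2

theorem so13_wedge (x v : Fin 4 → ℝ) (s : ℝ) :
    so13 (fun i j => (v i * lowr x j - x i * lowr v j) / s) := by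
  intro μ ν
  fin_cases μ <;> fin_cases ν <;> simp [etaF, lowr_eq] <;> ring_nf <;> simp

theorem h00_deriv (h : (Fin 4 → ℝ) → Fin 4 → Fin 4 → ℝ) (x : Fin 4 → ℝ) (hx : 0 < mdot x x)
    (hx0 : 0 < x 0) (hsym : ∀ μ ν, h x μ ν = h x ν μ)
    (hinv : ∀ A : Fin 4 → Fin 4 → ℝ, ∀ b : Fin 4 → ℝ, so13 A →
      ∀ μ ν, lieH (xiP2 A b) h x μ ν = 0) (v : Fin 4 → ℝ) :
    fderiv ℝ (fun y => h y 0 0) x v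
      = 2 * (h x 0 0 / x 0 ^ 2) * x 0 * (v 0 + mdot v x / mdot x x * x 0) := by
  have hf := h_form h x hx0 hsym hinv
  have hs := hx.ne'
  set s := mdot x x with hsdef
  set f := h x 0 0 / x 0 ^ 2 with hfdef
  let A : Fin 4 → Fin 4 → ℝ := fun i j => (v i * lowr x j - x i * lowr v j) / s
  let b : Fin 4 → ℝ := fun i => mdot v x / s ^ 2 * x i
  have hb : mdot b x = mdot v x / s := by
    have : mdot b x = mdot v x / s ^ 2 * s := by
      simp only [hsdef, b, mdot_eq]; ring
    rw [this]; field_simp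
  have hA : ∀ i, ∑ l, A i l * x l = v i - x i * (mdot v x / s) := by
    intro i
    have : ∑ l, A i l * x l = (v i * s - x i * mdot v x) / s := by
      rw [hsdef, mdot_lowr x x, mdot_lowr v x, Finset.mul_sum, Finset.mul_sum,
        ← Finset.sum_sub_distrib, Finset.sum_div]
      refine Finset.sum_congr rfl fun l _ => ?_
      simp only [A, hsdef, mdot_lowr x x]
      ring
    rw [this]; field_simp
  have hxi : xiP2 A b x = v := by
    ext i
    simp only [xiP2, hA, hb]; ring
  have key := hinv A b (so13_wedge x v s) 0 0
  rw [lieH_eq, hxi] at key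
  have hsum : ∑ l, x l * (A 0 l + lowr b l * x 0 + mdot b x * (if 0 = l then 1 else 0))
      = (∑ l, A 0 l * x l) + 2 * mdot b x * x 0 := by
    simp only [mul_add, Finset.sum_add_distrib]
    have : mdot b x * x 0 = ∑ l, x l * (lowr b l * x 0) := by
      rw [mdot_lowr, Finset.sum_mul]
      exact Finset.sum_congr rfl fun l _ => by ring
    rw [← this]
    simp [mul_comm (x _)]
    ring
  have s1 : ∑ l, h x 0 l * (A 0 l + lowr b l * x 0 + mdot b x * (if 0 = l then 1 else 0))
      = f * x 0 * (v 0 + mdot v x / s * x 0) := by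
    have : ∑ l, h x 0 l * (A 0 l + lowr b l * x 0 + mdot b x * (if 0 = l then 1 else 0))
      = f * x 0 *
        ∑ l, x l * (A 0 l + lowr b l * x 0 + mdot b x * (if 0 = l then 1 else 0)) := by
      rw [Finset.mul_sum]
      exact Finset.sum_congr rfl fun l _ => by rw [hf 0 l]; ring
    rw [this, hsum, hA, hb]; ring
  simp only [hsym _ 0] at key
  rw [s1] at key
  linarith

/-- Uniqueness of the 𝔭₂-invariant contravariant metric on the region x·x > 0, x⁰ > 0. -/
theorem stmt_4 (h : (Fin 4 → ℝ) → Fin 4 → Fin 4 → ℝ)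
    (hsmooth : ∀ μ ν, ContDiffOn ℝ (⊤ : ℕ∞) (fun x => h x μ ν)
      {x : Fin 4 → ℝ | 0 < mdot x x ∧ 0 < x 0})
    (hsym : ∀ x ∈ {x : Fin 4 → ℝ | 0 < mdot x x ∧ 0 < x 0}, ∀ μ ν, h x μ ν = h x ν μ)
    (hinv : ∀ A : Fin 4 → Fin 4 → ℝ, ∀ b : Fin 4 → ℝ, so13 A →
      ∀ x ∈ {x : Fin 4 → ℝ | 0 < mdot x x ∧ 0 < x 0}, ∀ μ ν, lieH (xiP2 A b) h x μ ν = 0) :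
    ∃ C : ℝ, ∀ x ∈ {x : Fin 4 → ℝ | 0 < mdot x x ∧ 0 < x 0}, ∀ μ ν,
      h x μ ν = C * (mdot x x * x μ * x ν) := by
  have hF : ∀ x ∈ {x : Fin 4 → ℝ | 0 < mdot x x ∧ 0 < x 0},
      HasFDerivAt (fun y => h y 0 0 / (mdot y y * y 0 ^ 2)) (0 : (Fin 4 → ℝ) →L[ℝ] ℝ) x := by
    intro x hx
    have hx0 : 0 < x 0 := hx.2
    have hxs : 0 < mdot x x := hx.1
    have hd : HasFDerivAt (fun y => h y 0 0) (fderiv ℝ (fun y => h y 0 0) x) x :=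
      (((hsmooth 0 0).contDiffAt (U_open.mem_nhds hx)).differentiableAt (by simp)).hasFDerivAt
    have hp : ∀ i : Fin 4, HasFDerivAt (fun y : Fin 4 → ℝ => y i)
        (ContinuousLinearMap.proj (R := ℝ) (φ := fun _ : Fin 4 => ℝ) i) x :=
      fun i => hasFDerivAt_apply i x
    have hm := ((((hp 0).mul (hp 0)).sub ((hp 1).mul (hp 1))).sub ((hp 2).mul (hp 2))).sub
      ((hp 3).mul (hp 3))
    have hm' : HasFDerivAt (fun y => mdot y y) _ x :=
      hm.congr_of_eventuallyEq (Filter.Eventually.of_forall fun y => mdot_eq y y)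
    have hden := hm'.mul ((hp 0).pow 2)
    have hq := hd.mul (((hasDerivAt_inv (mul_pos hxs (pow_pos hx0 2)).ne').comp_hasFDerivAt x hden))
    refine HasFDerivAt.congr_fderiv
      (hq.congr_of_eventuallyEq (Filter.Eventually.of_forall fun y => ?_)) ?_
    · simp [div_eq_mul_inv]
    · ext1 v
      have hv := h00_deriv h x hxs hx0 (hsym x hx) (fun A b hA => hinv A b hA x hx) v
      simp [hv]
      have hmv := mdot_eq v x
      have hne := hxs.ne'
      field_simp
      rw [hmv]
      ring
  have hconst : ∀ x ∈ {x : Fin 4 → ℝ | 0 < mdot x x ∧ 0 < x 0},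
      ∀ y ∈ {x : Fin 4 → ℝ | 0 < mdot x x ∧ 0 < x 0},
      h x 0 0 / (mdot x x * x 0 ^ 2) = h y 0 0 / (mdot y y * y 0 ^ 2) := by
    intro x hx y hy
    exact U_open.is_const_of_fderiv_eq_zero (𝕜 := ℝ) U_convex.isPreconnected
      (fun z hz => (hF z hz).differentiableAt.differentiableWithinAt)
      (fun z hz => (hF z hz).fderiv) hx hy
  let e : Fin 4 → ℝ := fun i => if i = 0 then 1 else 0
  have he : e ∈ {x : Fin 4 → ℝ | 0 < mdot x x ∧ 0 < x 0} := by
    simp [e, mdot_eq]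
  refine ⟨h e 0 0 / (mdot e e * e 0 ^ 2), fun x hx μ ν => ?_⟩
  rw [← hconst x hx e he, h_form h x hx.2 (hsym x hx) (fun A b hA => hinv A b hA x hx) μ ν]
  have h1 := hx.1.ne'
  have h2 := hx.2.ne'
  field_simp
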